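/- For every n ≥ 2 there is a function F : ℝⁿ → ℝ such that F ∈ ReLU_{n,k} for k = ⌈log₂(n+1)⌉, F ∈ ReLU⁺_{n,n} (so F is computable by a monotone ReLU network), and yet F ∉ ReLU⁺_{n,n−1}: an exponential depth separation between general and monotone ReLU networks. -/

import Mathlib

noncomputable section

/-- The rectified linear unit. -/
def relu (t : ℝ) : ℝ := max 0 t

/-- `ReLUplus n k F` : `F : ℝⁿ → ℝ` is computable by a depth-`k` monotone ReLU network. -/
inductive ReLUplus (n : ℕ) : ℕ → ((Fin n → ℝ) → ℝ) → Prop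
  | affine (a : Fin n → ℝ) (b : ℝ) (ha : ∀ i, 0 ≤ a i) :
      ReLUplus n 0 (fun x => (∑ i, a i * x i) + b)
  | comb {k : ℕ} {F G : (Fin n → ℝ) → ℝ} (c c' b : ℝ) (hc : 0 ≤ c) (hc' : 0 ≤ c')
      (hF : ReLUplus n k F) (hG : ReLUplus n k G) :
      ReLUplus n k (fun x => c * F x + c' * G x + b)
  | act {k : ℕ} {F : (Fin n → ℝ) → ℝ} (hF : ReLUplus n k F) :
      ReLUplus n (k + 1) (fun x => relu (F x))
  | deepen {k : ℕ} {F : (Fin n → ℝ) → ℝ} (hF : ReLUplus n k F) :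
      ReLUplus n (k + 1) F

/-- `ReLUnet n k F` : `F : ℝⁿ → ℝ` is computable by a depth-`k` (general) ReLU network. -/
inductive ReLUnet (n : ℕ) : ℕ → ((Fin n → ℝ) → ℝ) → Prop
  | affine (a : Fin n → ℝ) (b : ℝ) :
      ReLUnet n 0 (fun x => (∑ i, a i * x i) + b)
  | comb {k : ℕ} {F G : (Fin n → ℝ) → ℝ} (c c' b : ℝ)
      (hF : ReLUnet n k F) (hG : ReLUnet n k G) :
      ReLUnet n k (fun x => c * F x + c' * G x + b)
  | act {k : ℕ} {F : (Fin n → ℝ) → ℝ} (hF : ReLUnet n k F) :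
      ReLUnet n (k + 1) (fun x => relu (F x))
  | deepen {k : ℕ} {F : (Fin n → ℝ) → ℝ} (hF : ReLUnet n k F) :
      ReLUnet n (k + 1) F

/-! ### The separating function -/

/-- The nested function `relu (x₀ + relu (x₁ + ⋯ + relu xₙ₋₁))`, which is the maximum of `0` and the
partial sums of the coordinates. -/
def nestedRelu : (n : ℕ) → (Fin n → ℝ) → ℝ
  | 0, _ => 0
  | n + 1, x => relu (x 0 + nestedRelu n (Fin.tail x))

@[simp]
theorem nestedRelu_cons {n : ℕ} (a : ℝ) (v : Fin n → ℝ) :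
    nestedRelu (n + 1) (Fin.cons a v) = relu (a + nestedRelu n v) := by
  simp [nestedRelu]

theorem relu_nonneg (t : ℝ) : 0 ≤ relu t := le_max_left _ _

theorem relu_of_nonneg {t : ℝ} (h : 0 ≤ t) : relu t = t := max_eq_right h

theorem relu_of_nonpos {t : ℝ} (h : t ≤ 0) : relu t = 0 := max_eq_left h

theorem relu_mono : Monotone relu := fun _ _ h => max_le_max_left _ h

theorem nestedRelu_nonneg : ∀ (n : ℕ) (x : Fin n → ℝ), 0 ≤ nestedRelu n x
  | 0, _ => le_rfl
  | _ + 1, _ => relu_nonneg _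

theorem nestedRelu_mono : ∀ n : ℕ, Monotone (nestedRelu n)
  | 0 => monotone_const
  | n + 1 => fun _ _ h =>
      relu_mono (add_le_add (h 0) (nestedRelu_mono n fun i => h i.succ))

theorem nestedRelu_smul {t : ℝ} (ht : 0 ≤ t) :
    ∀ (n : ℕ) (x : Fin n → ℝ), nestedRelu n (t • x) = t * nestedRelu n x
  | 0, _ => (mul_zero t).symm
  | n + 1, x => by
      have h : Fin.tail (t • x) = t • Fin.tail x := rfl
      simp only [nestedRelu, h, nestedRelu_smul ht n, relu, Pi.smul_apply, smul_eq_mul]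
      rw [← mul_add, mul_max_of_nonneg _ _ ht, mul_zero]

@[simp]
theorem nestedRelu_zero (n : ℕ) : nestedRelu n 0 = 0 := by
  simpa using nestedRelu_smul le_rfl n 0

/-! ### Upper bounds -/

theorem ReLUplus.comp_tail {n k : ℕ} {F : (Fin n → ℝ) → ℝ} (hF : ReLUplus n k F) :
    ReLUplus (n + 1) k (fun x => F (Fin.tail x)) := by
  induction hF with
  | affine a b ha =>
      have h := ReLUplus.affine (n := n + 1) (Fin.cons 0 a) b
        (Fin.cases le_rfl fun i => by simpa using ha i)
      simpa [Fin.sum_univ_succ, Fin.tail] using h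
  | comb c c' b hc hc' _ _ ihF ihG => exact .comb c c' b hc hc' ihF ihG
  | act _ ih => exact .act ih
  | deepen _ ih => exact .deepen ih

theorem ReLUplus.mono_depth {n k l : ℕ} {F : (Fin n → ℝ) → ℝ} (hF : ReLUplus n k F) (h : k ≤ l) :
    ReLUplus n l F := by
  induction h with
  | refl => exact hF
  | step _ ih => exact .deepen ih

theorem reLUplus_nestedRelu (n : ℕ) : ReLUplus n n (nestedRelu n) := by
  induction n with
  | zero =>
      convert ReLUplus.affine (n := 0) 0 0 (fun _ => le_rfl) using 1
      funext x
      simp [nestedRelu]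
  | succ n ih =>
      have hx : ReLUplus (n + 1) n (fun x => x 0) := by
        have h := ReLUplus.affine (n := n + 1) (Fin.cons 1 0) 0
          (Fin.cases (by simp) fun i => by simp)
        exact ReLUplus.mono_depth (by simpa [Fin.sum_univ_succ] using h) n.zero_le
      simpa [nestedRelu] using
        (ReLUplus.comb 1 1 0 zero_le_one zero_le_one hx ih.comp_tail).act

theorem ReLUnet.max {n k : ℕ} {F G : (Fin n → ℝ) → ℝ} (hF : ReLUnet n k F) (hG : ReLUnet n k G) :
    ReLUnet n (k + 1) (fun x => max (F x) (G x)) := by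
  have h := ReLUnet.comb 1 1 0 hF.deepen (ReLUnet.comb 1 (-1) 0 hG hF).act
  convert h using 2 with x
  simp only [relu, one_mul, add_zero, ← max_add_add_left]
  congr 1
  ring

theorem reLUnet_sup' {n : ℕ} {ι : Type*} (A : ι → Fin n → ℝ) (k : ℕ) :
    ∀ (s : Finset ι) (hs : s.Nonempty), s.card ≤ 2 ^ k →
      ReLUnet n k (fun x => s.sup' hs fun j => ∑ i, A j i * x i) := by
  classical
  induction k with
  | zero =>
      intro s hs hcard
      obtain ⟨j, rfl⟩ := Finset.card_eq_one.1 (le_antisymm (by simpa using hcard) hs.card_pos)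
      simpa using ReLUnet.affine (A j) 0
  | succ k ih =>
      intro s hs hcard
      by_cases hk : s.card ≤ 2 ^ k
      · exact (ih s hs hk).deepen
      · obtain ⟨t, hts, ht⟩ := Finset.exists_subset_card_eq (le_of_not_ge hk)
        have hsdiff := Finset.card_sdiff_add_card_eq_card hts
        have ht₀ : t.Nonempty := Finset.card_pos.1 (by rw [ht]; positivity)
        have hd₀ : (s \ t).Nonempty := Finset.card_pos.1 (by omega)
        have h := (ih t ht₀ ht.le).max (ih (s \ t) hd₀ (by rw [pow_succ] at hcard; omega))
        convert h using 2 with x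
        rw [← Finset.sup'_union]
        exact Finset.sup'_congr _ (Finset.union_sdiff_of_subset hts).symm fun _ _ => rfl

theorem exists_nestedRelu_eq_sup' (n : ℕ) : ∃ A : Fin (n + 1) → Fin n → ℝ, ∀ x,
    nestedRelu n x = Finset.univ.sup' Finset.univ_nonempty fun j => ∑ i, A j i * x i := by
  induction n with
  | zero => exact ⟨0, fun x => by simp [nestedRelu]⟩
  | succ n ih =>
      obtain ⟨A, hA⟩ := ih
      refine ⟨Fin.cons 0 fun j => Fin.cons 1 (A j), fun x => ?_⟩
      have hle := fun j => (Finset.le_sup' (fun j => ∑ i, A j i * Fin.tail x i)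
        (Finset.mem_univ j)).trans_eq (hA (Fin.tail x)).symm
      obtain ⟨j, -, hj⟩ := Finset.exists_mem_eq_sup' Finset.univ_nonempty
        fun j => ∑ i, A j i * Fin.tail x i
      rw [← hA] at hj
      simp only [Fin.tail] at hle hj
      apply le_antisymm
      · refine max_le ?_ ?_
        · exact Finset.le_sup'_of_le _ (Finset.mem_univ 0) (by simp)
        · refine Finset.le_sup'_of_le _ (Finset.mem_univ j.succ) ?_
          simp [Fin.sum_univ_succ, ← hj]
      · refine Finset.sup'_le _ _ fun j _ => ?_
        refine Fin.cases ?_ (fun j => ?_) j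
        · simpa using nestedRelu_nonneg _ x
        · refine le_max_of_le_right ?_
          simpa [Fin.sum_univ_succ] using hle j

theorem reLUnet_nestedRelu (n : ℕ) : ReLUnet n (Nat.clog 2 (n + 1)) (nestedRelu n) := by
  obtain ⟨A, hA⟩ := exists_nestedRelu_eq_sup' n
  rw [funext hA]
  exact reLUnet_sup' A _ _ _ (by simpa using Nat.le_pow_clog one_lt_two (n + 1))

/-! ### Lower bound -/

theorem ReLUplus.monotone {n k : ℕ} {F : (Fin n → ℝ) → ℝ} (hF : ReLUplus n k F) :
    Monotone F := by
  induction hF with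
  | affine a b ha =>
      intro x y h
      have := Finset.sum_le_sum fun i (_ : i ∈ Finset.univ) =>
        mul_le_mul_of_nonneg_left (h i) (ha i)
      simpa using this
  | comb c c' b hc hc' _ _ ihF ihG =>
      intro x y h
      have := ihF h
      have := ihG h
      dsimp only
      gcongr
  | act _ ih => exact relu_mono.comp ih
  | deepen _ ih => exact ih

theorem ReLUplus.convex {n k : ℕ} {F : (Fin n → ℝ) → ℝ} (hF : ReLUplus n k F)
    (x y : Fin n → ℝ) {s t : ℝ} (hs : 0 ≤ s) (ht : 0 ≤ t) (hst : s + t = 1) :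
    F (s • x + t • y) ≤ s * F x + t * F y := by
  induction hF with
  | affine a b ha =>
      have h : ∑ i, a i * (s • x + t • y) i = s * ∑ i, a i * x i + t * ∑ i, a i * y i := by
        rw [Finset.mul_sum, Finset.mul_sum, ← Finset.sum_add_distrib]
        refine Finset.sum_congr rfl fun i _ => ?_
        simp only [Pi.add_apply, Pi.smul_apply, smul_eq_mul]
        ring
      dsimp only
      rw [h]
      exact le_of_eq (by linear_combination (-b) * hst)
  | comb c c' b hc hc' _ _ ihF ihG =>
      have hF := mul_le_mul_of_nonneg_left ihF hc
      have hG := mul_le_mul_of_nonneg_left ihG hc'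
      have hb : b = s * b + t * b := by rw [← add_mul, hst, one_mul]
      linarith
  | @act _ F _ ih =>
      refine max_le (add_nonneg (mul_nonneg hs (relu_nonneg _)) (mul_nonneg ht (relu_nonneg _))) ?_
      exact ih.trans (add_le_add (mul_le_mul_of_nonneg_left (le_max_right _ _) hs)
        (mul_le_mul_of_nonneg_left (le_max_right _ _) ht))
  | deepen _ ih => exact ih

/-- Fixing the first coordinate to `r` preserves depth. -/
theorem ReLUplus.comp_cons {n k : ℕ} (r : ℝ) {F : (Fin (n + 1) → ℝ) → ℝ}
    (hF : ReLUplus (n + 1) k F) : ReLUplus n k (fun v => F (Fin.cons r v)) := by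
  induction hF with
  | affine a b ha =>
      have h := ReLUplus.affine (Fin.tail a) (a 0 * r + b) fun i => ha i.succ
      convert h using 2 with v
      simp only [Fin.sum_univ_succ, Fin.cons_zero, Fin.cons_succ, Fin.tail]
      ring
  | comb c c' b hc hc' _ _ ihF ihG => exact .comb c c' b hc hc' ihF ihG
  | act _ ih => exact .act ih
  | deepen _ ih => exact .deepen ih

/-- `H` respects every convex combination that `F` respects. -/
def AffineAlong {n : ℕ} (F H : (Fin n → ℝ) → ℝ) : Prop :=
  ∀ (x y : Fin n → ℝ) (s t : ℝ), 0 ≤ s → 0 ≤ t → s + t = 1 →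
    F (s • x + t • y) = s * F x + t * F y → H (s • x + t • y) = s * H x + t * H y

theorem AffineAlong.left_of_comb {n k : ℕ} {M F G : (Fin n → ℝ) → ℝ} {c c' b : ℝ}
    (h : AffineAlong M fun x => c * F x + c' * G x + b) (hF : ReLUplus n k F)
    (hG : ReLUplus n k G) (hc : 0 < c) (hc' : 0 ≤ c') : AffineAlong M F := by
  intro x y s t hs ht hst hM
  have heq := h x y s t hs ht hst hM
  have hG' := mul_le_mul_of_nonneg_left (hG.convex x y hs ht hst) hc'
  have hb : b = s * b + t * b := by rw [← add_mul, hst, one_mul]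
  refine le_antisymm (hF.convex x y hs ht hst) (le_of_mul_le_mul_left ?_ hc)
  dsimp only at heq
  linarith

/-- A nonnegative monotone function that is affine along `nestedRelu` is constant on the zero set
of `nestedRelu`. -/
theorem AffineAlong.eq_of_nestedRelu_eq_zero {n : ℕ} {H : (Fin n → ℝ) → ℝ}
    (h : AffineAlong (nestedRelu n) H) (hmono : Monotone H) (hnonneg : ∀ x, 0 ≤ H x)
    {x : Fin n → ℝ} (hx : nestedRelu n x = 0) : H x = H 0 := by
  have key : ∀ x p : Fin n → ℝ, nestedRelu n x = 0 → p ≤ x → H p = H x := by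
    intro x p hx hp
    have hzero : ∀ y ≤ x, nestedRelu n y = 0 := fun y hy =>
      le_antisymm ((nestedRelu_mono n hy).trans_eq hx) (nestedRelu_nonneg n y)
    refine le_antisymm (hmono hp) (not_lt.1 fun hlt => ?_)
    have hpos : 0 < H x := (hnonneg p).trans_lt hlt
    set ε : ℝ := (H x - H p) / (2 * H x) with hε
    have hε₀ : 0 < ε := div_pos (sub_pos.2 hlt) (by positivity)
    have hεH : ε * H x = (H x - H p) / 2 := by rw [hε]; field_simp
    have hε₁ : ε ≤ 1 := by
      rw [hε, div_le_one (by positivity)]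
      linarith [hnonneg p]
    set q : Fin n → ℝ := x + ε⁻¹ • (p - x) with hq
    have hqx : q ≤ x := add_le_of_nonpos_right
      (smul_nonpos_of_nonneg_of_nonpos (inv_nonneg.2 hε₀.le) (sub_nonpos.2 hp))
    have hcomb : (1 - ε) • x + ε • q = p := by
      rw [hq, smul_add, smul_smul, mul_inv_cancel₀ hε₀.ne']
      module
    have heq := h x q (1 - ε) ε (by linarith) hε₀.le (by ring)
      (by rw [hcomb, hzero p hp, hzero q hqx, hx]; ring)
    rw [hcomb] at heq
    have := mul_nonneg hε₀.le (hnonneg q)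
    linarith
  rw [← key x (x ⊓ 0) hx inf_le_left, key 0 (x ⊓ 0) (nestedRelu_zero n) inf_le_right]

/-- A nonnegative monotone function that is affine along `nestedRelu` is an affine function of
`nestedRelu`. -/
theorem AffineAlong.eq_add_mul_nestedRelu {n : ℕ} {H : (Fin (n + 1) → ℝ) → ℝ}
    (h : AffineAlong (nestedRelu (n + 1)) H) (hmono : Monotone H) (hnonneg : ∀ x, 0 ≤ H x)
    (x : Fin (n + 1) → ℝ) :
    H x = H 0 + (H (Fin.cons 1 0) - H 0) * nestedRelu (n + 1) x := by
  have hray : ∀ r : ℝ, 0 ≤ r → H (Fin.cons r 0) = H 0 + (H (Fin.cons 1 0) - H 0) * r := by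
    have hscale : ∀ r s : ℝ, 0 ≤ r → 0 ≤ s → s ≤ 1 →
        H (Fin.cons (s * r) 0) = s * H (Fin.cons r 0) + (1 - s) * H 0 := by
      intro r s hr hs hs₁
      have hcomb : s • (Fin.cons r 0 : Fin (n + 1) → ℝ) + (1 - s) • 0 = Fin.cons (s * r) 0 := by
        funext i
        refine Fin.cases ?_ (fun i => ?_) i <;> simp
      rw [← hcomb]
      refine h _ _ s (1 - s) hs (by linarith) (by ring) ?_
      rw [hcomb]
      simp [relu_of_nonneg hr, relu_of_nonneg (mul_nonneg hs hr)]
    intro r hr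
    rcases le_total r 1 with hr₁ | hr₁
    · have := hscale 1 r zero_le_one hr hr₁
      rw [mul_one] at this
      rw [this]
      ring
    · have hr₀ : 0 < r := zero_lt_one.trans_le hr₁
      have := hscale r r⁻¹ hr (inv_nonneg.2 hr) (inv_le_one_of_one_le₀ hr₁)
      rw [inv_mul_cancel₀ hr₀.ne'] at this
      rw [this]
      field_simp
      ring
  obtain ⟨a, v, rfl⟩ : ∃ a v, x = Fin.cons a v := ⟨x 0, Fin.tail x, (Fin.cons_self_tail x).symm⟩
  rcases le_total (a + nestedRelu n v) 0 with hs | hs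
  · have hz : nestedRelu (n + 1) (Fin.cons a v) = 0 := by simp [relu_of_nonpos hs]
    rw [h.eq_of_nestedRelu_eq_zero hmono hnonneg hz, hz, mul_zero, add_zero]
  · set r := a + nestedRelu n v with hr
    have hhom := nestedRelu_smul zero_le_two n v
    set y : Fin (n + 1) → ℝ := Fin.cons (-(2 * nestedRelu n v)) ((2 : ℝ) • v) with hy
    have hy₀ : nestedRelu (n + 1) y = 0 := by simp [hy, hhom, relu]
    have hcomb : (2⁻¹ : ℝ) • y + (2⁻¹ : ℝ) • (Fin.cons (2 * r) 0 : Fin (n + 1) → ℝ)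
        = Fin.cons a v := by
      funext i
      refine Fin.cases ?_ (fun i => ?_) i
      · simp [hy, hr]
      · simp [hy]
    have heq := h y (Fin.cons (2 * r) 0) 2⁻¹ 2⁻¹ (by norm_num) (by norm_num) (by norm_num) (by
      rw [hcomb, hy₀]
      simp [← hr, relu_of_nonneg hs, relu_of_nonneg (mul_nonneg zero_le_two hs)])
    rw [hcomb, h.eq_of_nestedRelu_eq_zero hmono hnonneg hy₀, hray _ (by linarith)] at heq
    rw [heq, nestedRelu_cons, ← hr, relu_of_nonneg hs]
    ring

theorem affineAlong_add_mul {n : ℕ} (F : (Fin n → ℝ) → ℝ) (b μ : ℝ) :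
    AffineAlong F fun x => b + μ * F x := by
  intro x y s t _ _ hst hF
  dsimp only
  rw [hF]
  linear_combination (-b) * hst

/-- A monotone network of depth at most `n` on `n + 1` inputs that is affine along `nestedRelu` has
no kink at the origin in the first coordinate direction. -/
theorem ReLUplus.no_kink {n k : ℕ} {H : (Fin (n + 1) → ℝ) → ℝ} (hH : ReLUplus (n + 1) k H)
    (hk : k ≤ n) (hA : AffineAlong (nestedRelu (n + 1)) H) :
    H (Fin.cons 1 0) + H (Fin.cons (-1) 0) = 2 * H 0 := by
  induction n generalizing k with
  | zero => ?_
  | succ n ih => ?_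
  all_goals
    induction hH with
    | affine a b ha =>
        simp [Fin.sum_univ_succ]
        ring
    | @comb _ F G c c' b hc hc' hF hG ihF ihG =>
        have h₁ : c * (F (Fin.cons 1 0) + F (Fin.cons (-1) 0)) = c * (2 * F 0) := by
          rcases hc.eq_or_lt with rfl | hc
          · simp
          · rw [ihF hk (hA.left_of_comb hF hG hc hc')]
        have h₂ : c' * (G (Fin.cons 1 0) + G (Fin.cons (-1) 0)) = c' * (2 * G 0) := by
          rcases hc'.eq_or_lt with rfl | hc'
          · simp
          · rw [ihG hk (AffineAlong.left_of_comb (c' := c) (b := b)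
              (by simpa only [add_comm (c' * _)] using hA) hG hF hc' hc)]
        linear_combination h₁ + h₂
    | deepen _ ihF => exact ihF (by omega) hA
    | @act k F hF _ => ?_
  · omega
  · have hmono := hF.act.monotone
    have hform := hA.eq_add_mul_nestedRelu hmono fun x => relu_nonneg _
    set b := relu (F 0) with hb
    set μ := relu (F (Fin.cons 1 0)) - b with hμ
    have hneg : relu (F (Fin.cons (-1) 0)) = b := by
      have := hform (Fin.cons (-1) 0)
      simpa [relu_of_nonpos] using this
    have hμ_nonneg : 0 ≤ μ := sub_nonneg.2 (hmono
      (show (0 : Fin (n + 1 + 1) → ℝ) ≤ Fin.cons 1 0 from Fin.cases (by simp) fun i => by simp))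
    rcases hμ_nonneg.eq_or_lt with hμ₀ | hμ₀
    · dsimp only
      rw [hneg, ← hb]
      linarith
    · have hres : (fun v => F (Fin.cons 1 v)) = fun v => (b + μ) + μ * nestedRelu (n + 1) v := by
        funext v
        have hv := nestedRelu_nonneg (n + 1) v
        have hb₀ : 0 ≤ b := relu_nonneg _
        have := hform (Fin.cons 1 v)
        rw [nestedRelu_cons, relu_of_nonneg (t := 1 + _) (by linarith)] at this
        have hpos : 0 < relu (F (Fin.cons 1 v)) := by
          rw [this]
          have : 0 < μ * (1 + nestedRelu (n + 1) v) := mul_pos hμ₀ (by linarith)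
          linarith
        have hF₀ : 0 ≤ F (Fin.cons 1 v) := by
          by_contra hlt
          exact hpos.ne' (relu_of_nonpos (le_of_not_ge hlt))
        rw [relu_of_nonneg hF₀] at this
        rw [this]
        ring
      have hkink := ih (hres ▸ hF.comp_cons 1) (by omega) (affineAlong_add_mul _ _ _)
      have h₁ : relu (1 : ℝ) = 1 := relu_of_nonneg zero_le_one
      have h₂ : relu (-1 : ℝ) = 0 := relu_of_nonpos (by norm_num)
      simp only [nestedRelu_cons, nestedRelu_zero, add_zero, h₁, h₂] at hkink
      linarith

theorem not_reLUplus_nestedRelu (n : ℕ) : ¬ ReLUplus (n + 1) n (nestedRelu (n + 1)) := by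
  intro h
  have hkink := h.no_kink le_rfl fun _ _ _ _ _ _ _ => id
  simp [relu] at hkink

/-- For every `n ≥ 2` there is `F : ℝⁿ → ℝ` computable by a general ReLU
network of depth `⌈log₂ (n+1)⌉`, computable by a depth-`n` monotone ReLU network, but not
computable by any monotone ReLU network of depth `n − 1`. -/
theorem exp_separation_monotone :
    ∀ n : ℕ, 2 ≤ n → ∃ F : (Fin n → ℝ) → ℝ,
      ReLUnet n (Nat.clog 2 (n + 1)) F ∧
      ReLUplus n n F ∧
      ¬ ReLUplus n (n - 1) F := by
  intro n hn
  obtain ⟨m, rfl⟩ : ∃ m, n = m + 1 := ⟨n - 1, by omega⟩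
  exact ⟨nestedRelu (m + 1), reLUnet_nestedRelu _, reLUplus_nestedRelu _,
    not_reLUplus_nestedRelu m⟩
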